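/- arXiv:1603.02116 — 5 statements merged into one kernel-verified Lean document; each statement's English description precedes it below -/
import Mathlib

section
/- For every real number a > 0, every positive integer k and every x > 0, the function f_k solves the ordinary differential equation f_k'(x)·μ_s(x) = (k/(k+1))·(f_k'(x)·μ_θ(x) - f_k''(x)), i.e., f_k'(x)·a·tanh(a·x) = (k/(k+1))·(f_k'(x)·a·coth(a·x) - f_k''(x)). -/
/-- The comparison function `f_k(x) = -(k/a)·(cosh(a·x))^(-1/k)`. -/
noncomputable def fcomp (a : ℝ) (k : ℕ) : ℝ → ℝ :=
  fun x => -((k : ℝ) / a) * Real.cosh (a * x) ^ (-(1 : ℝ) / (k : ℝ))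

lemma hasDerivAt_cosh_mul_rpow (a p x : ℝ) :
    HasDerivAt (fun y => Real.cosh (a * y) ^ p)
      (a * p * Real.sinh (a * x) * Real.cosh (a * x) ^ (p - 1)) x := by
  have h : HasDerivAt (fun y : ℝ => a * y) a x := by
    simpa using (hasDerivAt_id x).const_mul a
  convert h.cosh.rpow_const (p := p) (Or.inl (Real.cosh_pos (a * x)).ne') using 1
  ring

lemma deriv_fcomp {a : ℝ} (ha : a ≠ 0) {k : ℕ} (hk : k ≠ 0) :
    deriv (fcomp a k) =
      fun x => Real.sinh (a * x) * Real.cosh (a * x) ^ (-(1 : ℝ) / (k : ℝ) - 1) := by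
  funext x
  have hk' : (k : ℝ) ≠ 0 := Nat.cast_ne_zero.mpr hk
  refine (((hasDerivAt_cosh_mul_rpow a (-(1 : ℝ) / k) x).const_mul
    (-((k : ℝ) / a))).deriv).trans ?_
  field_simp

lemma deriv_deriv_fcomp {a : ℝ} (ha : a ≠ 0) {k : ℕ} (hk : k ≠ 0) (x : ℝ) :
    deriv (deriv (fcomp a k)) x =
      a * Real.cosh (a * x) * Real.cosh (a * x) ^ (-(1 : ℝ) / (k : ℝ) - 1) +
        a * (-(1 : ℝ) / (k : ℝ) - 1) * Real.sinh (a * x) ^ 2 *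
          (Real.cosh (a * x) ^ (-(1 : ℝ) / (k : ℝ) - 1) / Real.cosh (a * x)) := by
  rw [deriv_fcomp ha hk]
  have h : HasDerivAt (fun y : ℝ => a * y) a x := by
    simpa using (hasDerivAt_id x).const_mul a
  refine ((h.sinh.mul (hasDerivAt_cosh_mul_rpow a (-(1 : ℝ) / k - 1) x)).deriv).trans ?_
  rw [Real.rpow_sub_one (Real.cosh_pos (a * x)).ne' (-(1 : ℝ) / k - 1)]
  ring

theorem stmt_4 (a : ℝ) (ha : 0 < a) (k : ℕ) (hk : 0 < k) (x : ℝ) (hx : 0 < x) :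
    deriv (fcomp a k) x * (a * Real.tanh (a * x)) =
      ((k : ℝ) / ((k : ℝ) + 1)) *
        (deriv (fcomp a k) x * (a * (Real.cosh (a * x) / Real.sinh (a * x)))
          - deriv (deriv (fcomp a k)) x) := by
  have hk' : (k : ℝ) ≠ 0 := Nat.cast_ne_zero.mpr hk.ne'
  have hk1 : (k : ℝ) + 1 ≠ 0 := by positivity
  have hs : Real.sinh (a * x) ≠ 0 := (Real.sinh_pos_iff.mpr (mul_pos ha hx)).ne'
  have hc : Real.cosh (a * x) ≠ 0 := (Real.cosh_pos (a * x)).ne'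
  rw [deriv_deriv_fcomp ha.ne' hk.ne', deriv_fcomp ha.ne' hk.ne', Real.tanh_eq_sinh_div_cosh]
  dsimp only
  generalize Real.cosh (a * x) ^ (-(1 : ℝ) / (k : ℝ) - 1) = P
  field_simp
  ring
end

section
/- Let a > 0 be a real number, k a positive integer and r > 0 a real number such that cosh(a·r)² ≤ k + 1. Then g_k is strictly decreasing on the interval [0, r]: for all x, y with 0 ≤ x < y ≤ r one has g_k(y) < g_k(x). -/
/-- The function `g_k(x) = a·(k+1-cosh(a·x)²)/(k·(k+1)·(cosh(a·x))^((2k+1)/k))`. -/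
noncomputable def gcomp (a : ℝ) (k : ℕ) : ℝ → ℝ :=
  fun x => a * ((k : ℝ) + 1 - Real.cosh (a * x) ^ 2) /
    ((k : ℝ) * ((k : ℝ) + 1) * Real.cosh (a * x) ^ ((2 * (k : ℝ) + 1) / (k : ℝ)))

theorem stmt_9 (a : ℝ) (ha : 0 < a) (k : ℕ) (hk : 0 < k) (r : ℝ) (hr : 0 < r)
    (hcosh : Real.cosh (a * r) ^ 2 ≤ (k : ℝ) + 1) :
    ∀ x y : ℝ, 0 ≤ x → x < y → y ≤ r → gcomp a k y < gcomp a k x := by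
  intro x y hx hxy hyr
  have hk' : (0 : ℝ) < k := Nat.cast_pos.mpr hk
  have hcosh_mono : ∀ u v : ℝ, 0 ≤ u → u < v → Real.cosh (a * u) < Real.cosh (a * v) := by
    intro u v hu huv
    have hau : 0 ≤ a * u := by positivity
    have hauv : a * u < a * v := mul_lt_mul_of_pos_left huv ha
    rw [Real.cosh_lt_cosh, abs_of_nonneg hau, abs_of_nonneg (hau.trans hauv.le)]
    exact hauv
  have hx_pos : 0 < Real.cosh (a * x) := Real.cosh_pos _
  have hxy' := hcosh_mono x y hx hxy
  have hxr := hcosh_mono x r hx (hxy.trans_le hyr)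
  have hsq_xy : Real.cosh (a * x) ^ 2 < Real.cosh (a * y) ^ 2 := by gcongr
  have hsq_xr : Real.cosh (a * x) ^ 2 < Real.cosh (a * r) ^ 2 := by gcongr
  unfold gcomp
  refine div_lt_div₀ ?_ ?_ ?_ ?_
  · gcongr
  · gcongr
  · exact mul_nonneg ha.le (by linarith)
  · positivity
end

section
/- Let V be a 3-dimensional real inner product space (for instance EuclideanSpace ℝ (Fin 3)), let {G, S, Θ} and {E₁, E₂, η} be two orthonormal bases of V, and let m_s, m_θ be real numbers with 0 ≤ m_s ≤ m_θ. Then m_s·(⟪E₁,S⟫² + ⟪E₂,S⟫²) + m_θ·(⟪E₁,Θ⟫² + ⟪E₂,Θ⟫²) ≥ m_s + m_θ·⟪η,G⟫². -/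
open scoped RealInnerProductSpace

/-- Parseval's identity for an orthonormal family whose size is the dimension of the space. -/
theorem Orthonormal.sum_sq_inner_of_card_eq_finrank {ι V : Type*} [Fintype ι]
    [NormedAddCommGroup V] [InnerProductSpace ℝ V] {v : ι → V} (hv : Orthonormal ℝ v)
    [Nonempty ι] (hcard : Fintype.card ι = Module.finrank ℝ V) (x : V) :
    ∑ i, ⟪v i, x⟫ ^ 2 = ‖x‖ ^ 2 := by
  have hb : ⇑(basisOfOrthonormalOfCardEqFinrank hv hcard) = v :=
    coe_basisOfOrthonormalOfCardEqFinrank hv hcard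
  have h := OrthonormalBasis.sum_sq_inner_right
    ((basisOfOrthonormalOfCardEqFinrank hv hcard).toOrthonormalBasis (by rwa [hb])) x
  simpa [hb] using h

theorem stmt_11 {V : Type*} [NormedAddCommGroup V] [InnerProductSpace ℝ V]
    (hdim : Module.finrank ℝ V = 3)
    (G S Θ E₁ E₂ η : V)
    (hframe : Orthonormal ℝ ![G, S, Θ])
    (hE : Orthonormal ℝ ![E₁, E₂, η])
    (m_s m_θ : ℝ) (hms : 0 ≤ m_s) (hle : m_s ≤ m_θ) :
    m_s * (⟪E₁, S⟫ ^ 2 + ⟪E₂, S⟫ ^ 2) + m_θ * (⟪E₁, Θ⟫ ^ 2 + ⟪E₂, Θ⟫ ^ 2)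
      ≥ m_s + m_θ * ⟪η, G⟫ ^ 2 := by
  have hS : ‖S‖ = 1 := hframe.1 1
  have hΘ : ‖Θ‖ = 1 := hframe.1 2
  have hη : ‖η‖ = 1 := hE.1 2
  have hcard : Fintype.card (Fin 3) = Module.finrank ℝ V := by simp [hdim]
  have h₁ := hE.sum_sq_inner_of_card_eq_finrank hcard S
  have h₂ := hE.sum_sq_inner_of_card_eq_finrank hcard Θ
  have h₃ := hframe.sum_sq_inner_of_card_eq_finrank hcard η
  simp only [Fin.sum_univ_three, Matrix.cons_val, hS, hΘ, hη, one_pow] at h₁ h₂ h₃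
  rw [real_inner_comm η G, real_inner_comm η S, real_inner_comm η Θ] at h₃
  have hES : ⟪E₁, S⟫ ^ 2 + ⟪E₂, S⟫ ^ 2 = 1 - ⟪η, S⟫ ^ 2 := by linarith
  have hEΘ : ⟪E₁, Θ⟫ ^ 2 + ⟪E₂, Θ⟫ ^ 2 = ⟪η, G⟫ ^ 2 + ⟪η, S⟫ ^ 2 := by linarith
  rw [hES, hEΘ]
  linarith [mul_le_mul_of_nonneg_right hle (sq_nonneg ⟪η, S⟫)]
end

section
/- For all real numbers a > 0 and r > 0 there exist an infinitely differentiable function f : ℝ → ℝ and constants C₁ > 0 and C₂ > 0 such that 0 ≤ f'(x) ≤ C₁ for every x ∈ [0, r], and for every x ∈ (0, r], every c ∈ [-1, 1] and every real H with H² ≤ a², one has (f'(x)·a·coth(a·x) - f''(x))·c² + 2·H·f'(x)·c + f'(x)·a·tanh(a·x) + f''(x) ≥ C₂. -/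
theorem hasDerivAt_cosh_mul_div {a : ℝ} (ha : a ≠ 0) (x : ℝ) :
    HasDerivAt (fun y : ℝ => Real.cosh (a * y) / a) (Real.sinh (a * x)) x := by
  have h := (((hasDerivAt_id x).const_mul a).cosh).div_const a
  simpa [ha] using h

theorem hasDerivAt_sinh_mul (a x : ℝ) :
    HasDerivAt (fun y : ℝ => Real.sinh (a * y)) (a * Real.cosh (a * x)) x := by
  have h := ((hasDerivAt_id x).const_mul a).sinh
  simpa [mul_comm] using h

theorem stmt_13 (a r : ℝ) (ha : 0 < a) (hr : 0 < r) :
    ∃ f : ℝ → ℝ, ContDiff ℝ (⊤ : ℕ∞) f ∧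
      ∃ C₁ > (0 : ℝ), ∃ C₂ > (0 : ℝ),
        (∀ x ∈ Set.Icc (0 : ℝ) r, 0 ≤ deriv f x ∧ deriv f x ≤ C₁) ∧
        (∀ x ∈ Set.Ioc (0 : ℝ) r, ∀ c ∈ Set.Icc (-1 : ℝ) 1, ∀ H : ℝ, H ^ 2 ≤ a ^ 2 →
          (deriv f x * (a * (Real.cosh (a * x) / Real.sinh (a * x)))
              - deriv (deriv f) x) * c ^ 2
            + 2 * H * deriv f x * c
            + deriv f x * (a * Real.tanh (a * x))
            + deriv (deriv f) x
          ≥ C₂) := by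
  have h₁ : deriv (fun y : ℝ => Real.cosh (a * y) / a) = fun x => Real.sinh (a * x) :=
    funext fun x => (hasDerivAt_cosh_mul_div ha.ne' x).deriv
  have h₂ : deriv (fun x : ℝ => Real.sinh (a * x)) = fun x => a * Real.cosh (a * x) :=
    funext fun x => (hasDerivAt_sinh_mul a x).deriv
  refine ⟨fun y => Real.cosh (a * y) / a,
    (Real.contDiff_cosh.comp (contDiff_const.mul contDiff_id)).div_const a,
    Real.sinh (a * r), Real.sinh_pos_iff.2 (mul_pos ha hr),
    a * (Real.exp (-(a * r)) ^ 2 / Real.cosh (a * r)),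
    mul_pos ha (div_pos (pow_pos (Real.exp_pos _) 2) (Real.cosh_pos _)), ?_, ?_⟩
  · rintro x ⟨hx₀, hxr⟩
    simp only [h₁]
    exact ⟨Real.sinh_nonneg_iff.2 (by positivity), Real.sinh_le_sinh.2 (by gcongr)⟩
  · rintro x ⟨hx₀, hxr⟩ c ⟨hc₁, hc₂⟩ H hH
    simp only [h₁, h₂]
    have hs : 0 < Real.sinh (a * x) := Real.sinh_pos_iff.2 (mul_pos ha hx₀)
    have hC : 0 < Real.cosh (a * x) := Real.cosh_pos _
    have hHc : -a ≤ H * c := by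
      have hc : c ^ 2 ≤ 1 := by nlinarith
      exact (abs_le_of_sq_le_sq' (by nlinarith [sq_nonneg H]) ha.le).1
    have hexp : Real.exp (-(a * r)) ≤ Real.exp (-(a * x)) := by gcongr
    have hcosh : Real.cosh (a * x) ≤ Real.cosh (a * r) :=
      Real.cosh_le_cosh.2 (by
        rw [abs_of_pos (mul_pos ha hx₀), abs_of_pos (mul_pos ha hr)]; gcongr)
    calc a * (Real.exp (-(a * r)) ^ 2 / Real.cosh (a * r))
        ≤ a * (Real.exp (-(a * x)) ^ 2 / Real.cosh (a * x)) := by gcongr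
      _ = 2 * (-a) * Real.sinh (a * x) + Real.sinh (a * x) * (a * Real.tanh (a * x))
            + a * Real.cosh (a * x) := by
          rw [← Real.cosh_sub_sinh, Real.tanh_eq_sinh_div_cosh]
          field_simp
          ring
      _ ≤ 2 * (H * c) * Real.sinh (a * x) + Real.sinh (a * x) * (a * Real.tanh (a * x))
            + a * Real.cosh (a * x) := by gcongr
      _ = _ := by
          field_simp
          ring
end

section
/- Let u = (u_x, u_y) and v = (v_x, v_y) be vectors in ℝ², let k₁, k₂ be coprime integers and set d = u_x·v_y - u_y·v_x. Then for every c ∈ ℝ and every integer j there exists (m, n) ∈ ℤ × ℤ such that the image of P_{0,c}(k₁,k₂) under τ(m,n) equals P_{0, c + j·d}(k₁,k₂); in particular, the translation τ(k₁,k₂) maps P_{0,c}(k₁,k₂) onto itself for every c ∈ ℝ. -/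
/-- The parabolic translation `τ(m,n)(x,y,z) = (x + m·uₓ + n·vₓ, y + m·u_y + n·v_y, z)` on `ℝ³`. -/
def tauF (u v : ℝ × ℝ) (m n : ℤ) (p : ℝ × ℝ × ℝ) : ℝ × ℝ × ℝ :=
  (p.1 + (m : ℝ) * u.1 + (n : ℝ) * v.1, p.2.1 + (m : ℝ) * u.2 + (n : ℝ) * v.2, p.2.2)

/-- The vertical half-plane `P_{0,c}(k₁,k₂)`. -/
def P0 (u v : ℝ × ℝ) (k₁ k₂ : ℤ) (c : ℝ) : Set (ℝ × ℝ × ℝ) :=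
  {p | ((k₁ : ℝ) * u.2 + (k₂ : ℝ) * v.2) * p.1
        - ((k₁ : ℝ) * u.1 + (k₂ : ℝ) * v.1) * p.2.1 + c = 0 ∧ 0 < p.2.2}

/-- The translation `τ(m,n)` shifts the parameter `c` by `(k₁ n - k₂ m) d`. -/
theorem tauF_image_P0 (u v : ℝ × ℝ) (k₁ k₂ m n : ℤ) (c : ℝ) :
    tauF u v m n '' P0 u v k₁ k₂ c
      = P0 u v k₁ k₂ (c + ((k₁ * n - k₂ * m : ℤ) : ℝ) * (u.1 * v.2 - u.2 * v.1)) := by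
  ext ⟨x, y, z⟩
  simp only [Set.mem_image, P0, tauF, Set.mem_ofPred_eq]
  push_cast
  constructor
  · rintro ⟨⟨x', y', z'⟩, ⟨h, hz⟩, heq⟩
    simp only [Prod.mk.injEq] at heq
    obtain ⟨rfl, rfl, rfl⟩ := heq
    exact ⟨by linear_combination h, hz⟩
  · rintro ⟨h, hz⟩
    refine ⟨(x - m * u.1 - n * v.1, y - m * u.2 - n * v.2, z),
      ⟨by linear_combination h, hz⟩, ?_⟩
    ext <;> dsimp only <;> ring

theorem stmt_16 (u v : ℝ × ℝ) (k₁ k₂ : ℤ) (hcop : IsCoprime k₁ k₂) :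
    (∀ (c : ℝ) (j : ℤ), ∃ mn : ℤ × ℤ,
      tauF u v mn.1 mn.2 '' P0 u v k₁ k₂ c
        = P0 u v k₁ k₂ (c + (j : ℝ) * (u.1 * v.2 - u.2 * v.1))) ∧
    (∀ c : ℝ, tauF u v k₁ k₂ '' P0 u v k₁ k₂ c = P0 u v k₁ k₂ c) := by
  refine ⟨fun c j => ?_, fun c => ?_⟩
  · obtain ⟨a, b, hab⟩ := hcop
    refine ⟨(-(j * b), j * a), ?_⟩
    rw [tauF_image_P0, show k₁ * (j * a) - k₂ * -(j * b) = j by linear_combination j * hab]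
  · rw [tauF_image_P0, show k₁ * k₂ - k₂ * k₁ = 0 by ring]
    simp
end
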